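/- arXiv:0711.4857 — 4 statements merged into one kernel-verified Lean document; each statement's English description precedes it below -/
import Mathlib

section
/- For a fixed t ∈ ℤ, the matrix identity L_{t+1}(y) R_{t+M}(y) = R_t(y) L_t(y) holds for all y ∈ ℂ∖{0} if and only if for all n ∈ ℤ both I^{t+M}_n + V^{t+1}_{n−1} = I^t_n + V^t_n and V^{t+1}_n · I^{t+M}_n = I^t_{n+1} · V^t_n hold (the generalized periodic discrete Toda equations in polynomial form). -/
/-- The matrix `L_t(y)` of the periodic discrete Toda equation:
`(L)_{n,n} = 1`, `(L)_{n+1,n} = V_n` for `1 ≤ n ≤ N-1`, `(L)_{1,N} = V_N / y`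
(indices written 1-based; here `Fin N` is 0-based). -/
noncomputable def Lmat (N : ℕ) (V : ℤ → ℂ) (y : ℂ) : Matrix (Fin N) (Fin N) ℂ :=
  fun i j =>
    if (i : ℕ) = (j : ℕ) then 1
    else if (i : ℕ) = (j : ℕ) + 1 then V ((j : ℕ) + 1)
    else if (i : ℕ) = 0 ∧ (j : ℕ) = N - 1 then V N * y⁻¹
    else 0

/-- The matrix `R_t(y)` of the periodic discrete Toda equation:
`(R)_{n,n} = I_n`, `(R)_{n,n+1} = 1` for `1 ≤ n ≤ N-1`, `(R)_{N,1} = y`. -/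
noncomputable def Rmat (N : ℕ) (I : ℤ → ℂ) (y : ℂ) : Matrix (Fin N) (Fin N) ℂ :=
  fun i j =>
    if (i : ℕ) = (j : ℕ) then I ((i : ℕ) + 1)
    else if (j : ℕ) = (i : ℕ) + 1 then 1
    else if (i : ℕ) = N - 1 ∧ (j : ℕ) = 0 then y
    else 0

/-- `Rprod N I t y k = R_{t+k-1}(y) ⋯ R_{t+1}(y) R_t(y)`. -/
noncomputable def Rprod (N : ℕ) (I : ℤ → ℤ → ℂ) (t : ℤ) (y : ℂ) : ℕ → Matrix (Fin N) (Fin N) ℂ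
  | 0 => 1
  | k + 1 => Rmat N (I (t + k)) y * Rprod N I t y k

/-- `X_t(y) = L_t(y) R_{t+M-1}(y) ⋯ R_{t+1}(y) R_t(y)`. -/
noncomputable def Xmat (N M : ℕ) (I V : ℤ → ℤ → ℂ) (t : ℤ) (y : ℂ) : Matrix (Fin N) (Fin N) ℂ :=
  Lmat N (V t) y * Rprod N I t y M

theorem fin_succ_val (m : ℕ) (j : Fin (m+2)) :
    ((j + 1 : Fin (m+2)) : ℕ) = if (j:ℕ) = m+1 then 0 else (j:ℕ)+1 := by
  rw [Fin.val_add_one]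
  simp only [Fin.ext_iff, Fin.val_last]

theorem Lmat_eq (m : ℕ) (V : ℤ → ℂ) (y : ℂ) (i j : Fin (m+2)) :
    Lmat (m+2) V y i j = (if i = j then 1 else 0) +
      (if i = j + 1 then V ((j:ℕ)+1) * (if (j:ℕ) = m+1 then y⁻¹ else 1) else 0) := by
  have hi := i.2
  have hj := j.2
  have h := fin_succ_val m j
  unfold Lmat
  simp only [Fin.ext_iff, h]
  by_cases hj' : (j:ℕ) = m+1
  · have : (((m+2 : ℕ) : ℤ)) = ((m+1:ℕ):ℤ)+1 := by push_cast; ring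
    rw [this]
    simp only [hj', if_true]
    split_ifs <;> first | omega | simp
  · simp only [hj', if_false]
    split_ifs <;> first | omega | simp

theorem Rmat_eq (m : ℕ) (I : ℤ → ℂ) (y : ℂ) (i j : Fin (m+2)) :
    Rmat (m+2) I y i j = (if i = j then I ((i:ℕ)+1) else 0) +
      (if j = i + 1 then (if (i:ℕ) = m+1 then y else 1) else 0) := by
  have hi := i.2
  have hj := j.2
  have h := fin_succ_val m i
  unfold Rmat
  simp only [Fin.ext_iff, h]
  by_cases hj' : (i:ℕ) = m+1
  · simp only [hj', if_true]
    split_ifs <;> first | omega | simp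
  · simp only [hj', if_false]
    split_ifs <;> first | omega | simp

theorem LR_eq (m : ℕ) (I V : ℤ → ℂ) (hV : ∀ n : ℤ, V (n + (m+2:ℕ)) = V n)
    (y : ℂ) (hy : y ≠ 0) (i j : Fin (m+2)) :
    (Lmat (m+2) V y * Rmat (m+2) I y) i j =
      (if i = j then I ((i:ℕ)+1) + V (i:ℕ) else 0)
      + (if j = i + 1 then (if (i:ℕ) = m+1 then y else 1) else 0)
      + (if i = j + 1 then V ((j:ℕ)+1) * I ((j:ℕ)+1) * (if (j:ℕ) = m+1 then y⁻¹ else 1) else 0) := by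
  obtain ⟨p, rfl⟩ : ∃ p, i = p + 1 := ⟨i - 1, by simp⟩
  have hp : V (((p+1 : Fin (m+2)) : ℕ) : ℤ) = V ((p:ℕ)+1) := by
    rw [fin_succ_val]
    split_ifs with h
    · rw [h, ← hV ((0:ℕ):ℤ)]; congr 1; push_cast; ring
    · push_cast; rfl
  rw [Matrix.mul_apply, hp]
  have hs : ∀ k : Fin (m+2), Lmat (m+2) V y (p+1) k * Rmat (m+2) I y k j =
      (if p + 1 = k then Rmat (m+2) I y k j else 0) +
      (if p = k then V ((k:ℕ)+1) * (if (k:ℕ) = m+1 then y⁻¹ else 1) * Rmat (m+2) I y k j else 0) := by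
    intro k
    rw [Lmat_eq]
    simp only [add_left_inj, add_mul, ite_mul, zero_mul, one_mul]
  simp only [hs, Finset.sum_add_distrib, Finset.sum_ite_eq, Finset.mem_univ, if_true]
  simp only [Rmat_eq, add_left_inj]
  by_cases h1 : p = j
  · subst h1
    by_cases h2 : p + 1 = p
    · simp at h2
    · have h3 : ¬ p = p + 1 := fun h => h2 h.symm
      simp only [h2, h3, if_true, if_false]
      ring
  · by_cases h2 : p + 1 = j
    · subst h2
      simp only [h1, if_true, if_false]
      split_ifs <;> field_simp <;> ring
    · have h3 : ¬ j = p + 1 := fun h => h2 h.symm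
      simp only [h1, h2, h3, if_false]
      ring

theorem RL_eq (m : ℕ) (I V : ℤ → ℂ) 
    (y : ℂ) (hy : y ≠ 0) (i j : Fin (m+2)) :
    (Rmat (m+2) I y * Lmat (m+2) V y) i j =
      (if i = j then I ((i:ℕ)+1) + V ((i:ℕ)+1) else 0)
      + (if j = i + 1 then (if (i:ℕ) = m+1 then y else 1) else 0)
      + (if i = j + 1 then I ((i:ℕ)+1) * V ((j:ℕ)+1) * (if (j:ℕ) = m+1 then y⁻¹ else 1) else 0) := by
  rw [Matrix.mul_apply]
  have hs : ∀ k : Fin (m+2), Rmat (m+2) I y i k * Lmat (m+2) V y k j =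
      (if i = k then I ((i:ℕ)+1) * Lmat (m+2) V y k j else 0) +
      (if k = i + 1 then (if (i:ℕ) = m+1 then y else 1) * Lmat (m+2) V y k j else 0) := by
    intro k
    rw [Rmat_eq]
    simp only [add_mul, ite_mul, zero_mul, one_mul]
  simp only [hs, Finset.sum_add_distrib, Finset.sum_ite_eq, Finset.sum_ite_eq', Finset.mem_univ,
    if_true]
  simp only [Lmat_eq, add_left_inj]
  by_cases h1 : i = j
  · subst h1
    simp only [if_true]
    have h3 : ¬ i = i + 1 := by simp
    have h4 : ¬ i + 1 = i := by simp
    simp only [h3, h4, if_false]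
    split_ifs <;> field_simp <;> ring
  · by_cases h2 : i + 1 = j
    · subst h2
      simp only [h1, if_true, if_false]
      split_ifs <;> ring
    · have h3 : ¬ j = i + 1 := fun h => h2 h.symm
      simp only [h1, h2, h3, if_false]
      split_ifs <;> ring

theorem per_red (N : ℕ) (f : ℤ → ℂ) (hf : ∀ n : ℤ, f (n + N) = f n) (n k : ℤ) :
    f (n + k * N) = f n := by
  have : Function.Periodic f (N:ℤ) := hf
  exact this.int_mul k n

/-- For fixed `t`, the matrix identity
`L_{t+1}(y) R_{t+M}(y) = R_t(y) L_t(y)` holds for all `y ≠ 0` iff the generalized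
periodic discrete Toda equations (in polynomial form) hold for all `n ∈ ℤ`. -/
theorem matrix_form_iff_toda (N M : ℕ) (hN : 2 ≤ N) (hM : 1 ≤ M)
    (I V : ℤ → ℤ → ℂ)
    (hI : ∀ t n : ℤ, I t (n + N) = I t n) (hV : ∀ t n : ℤ, V t (n + N) = V t n)
    (t : ℤ) :
    (∀ y : ℂ, y ≠ 0 →
        Lmat N (V (t + 1)) y * Rmat N (I (t + M)) y = Rmat N (I t) y * Lmat N (V t) y) ↔
    (∀ n : ℤ, I (t + M) n + V (t + 1) (n - 1) = I t n + V t n ∧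
        V (t + 1) n * I (t + M) n = I t (n + 1) * V t n) := by
  obtain ⟨m, rfl⟩ : ∃ m, N = m + 2 := ⟨N - 2, by omega⟩
  have hne : ∀ i : Fin (m+2), i + 1 ≠ i := by
    intro i h
    have := fin_succ_val m i
    rw [h] at this
    split_ifs at this <;> omega
  have key : ∀ j : Fin (m+2), I t (((j+1 : Fin (m+2)) : ℕ) + 1) = I t (((j:ℕ):ℤ) + 1 + 1) := by
    intro j
    rw [fin_succ_val]
    split_ifs with h
    · rw [h, ← hI t]; congr 1; push_cast; ring
    · push_cast; rfl
  constructor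
  · intro h n
    have h1 := h 1 one_ne_zero
    obtain ⟨j, q, rfl⟩ : ∃ (j : Fin (m+2)) (q : ℤ), n = ((j:ℕ):ℤ) + 1 + q * (m+2:ℕ) := by
      have hpos : (0:ℤ) < (m+2:ℕ) := by positivity
      have a := Int.emod_nonneg (n-1) hpos.ne'
      have b := Int.emod_lt_of_pos (n-1) hpos
      refine ⟨⟨((n-1) % (m+2:ℕ)).toNat, by omega⟩, (n-1) / (m+2:ℕ), ?_⟩
      have c := Int.emod_add_mul_ediv (n-1) (m+2:ℕ)
      simp only [Int.toNat_of_nonneg a]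
      linarith
    have e1 : ((j:ℕ):ℤ) + 1 + q * (m+2:ℕ) - 1 = (j:ℕ) + q * (m+2:ℕ) := by ring
    have e2 : ((j:ℕ):ℤ) + 1 + q * (m+2:ℕ) + 1 = ((j:ℕ) + 1 + 1) + q * (m+2:ℕ) := by ring
    rw [e1, e2]
    simp only [per_red _ _ (hI _), per_red _ _ (hV _)]
    constructor
    · have := congrFun (congrFun h1 j) j
      rw [LR_eq _ _ _ (hV _) _ one_ne_zero, RL_eq _ _ _ _ one_ne_zero] at this
      simpa [(hne j).symm] using this
    · have := congrFun (congrFun h1 (j+1)) j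
      rw [LR_eq _ _ _ (hV _) _ one_ne_zero, RL_eq _ _ _ _ one_ne_zero, key] at this
      simpa [hne j] using this
  · intro h y hy
    ext i j
    rw [LR_eq _ _ _ (hV _) _ hy, RL_eq _ _ _ _ hy]
    have h1 := (h ((i:ℕ)+1)).1
    have h2 := (h ((j:ℕ)+1)).2
    rw [add_sub_cancel_right] at h1
    rw [h1, h2]
    congr 1
    by_cases hij : i = j + 1
    · subst hij
      rw [key]
    · simp [hij]
end

section
/- For every t ∈ ℤ and every y ∈ ℂ∖{0}, det X_t(y) = y^{−1} · (y + (−1)^{N+1} ∏_{n=1}^{N} V^t_n) · ∏_{k=0}^{M−1} ((∏_{n=1}^{N} I^{t+k}_n) + (−1)^{N+1} y). -/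
theorem det_cyc_aux (m : ℕ) (a b : ℕ → ℂ) (c : ℂ) (A : Matrix (Fin (m+2)) (Fin (m+2)) ℂ)
    (hA : ∀ i j, A i j = if (i : ℕ) = (j : ℕ) then a i
      else if (j : ℕ) = (i : ℕ) + 1 then b i
      else if (i : ℕ) = m + 1 ∧ (j : ℕ) = 0 then c else 0) :
    A.det = (∏ i ∈ Finset.range (m+2), a i) + (-1) ^ (m+1) * c * ∏ i ∈ Finset.range (m+1), b i := by
  rw [Matrix.det_succ_column_zero, Fin.sum_univ_succ, Fin.sum_univ_castSucc]
  have h0 : ∀ x : Fin m, A x.castSucc.succ 0 = 0 := by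
    intro x
    have := x.isLt
    rw [hA]
    simp
    omega
  have h1 : A 0 0 = a 0 := by rw [hA]; simp
  have h2 : A (Fin.last m).succ 0 = c := by rw [hA]; simp
  have d1 : (A.submatrix (Fin.succAbove 0) Fin.succ).det = ∏ i ∈ Finset.range (m+1), a (i+1) := by
    rw [Matrix.det_of_upperTriangular, Finset.prod_range]
    · apply Finset.prod_congr rfl
      intro i _
      simp [hA]
    · intro i j hij
      have hij : (j : ℕ) < i := hij
      simp only [Matrix.submatrix_apply, hA, Fin.succAbove_zero, Fin.val_succ]
      rw [if_neg (by omega), if_neg (by omega), if_neg (by omega)]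
  have d2 : (A.submatrix (Fin.succAbove (Fin.last m).succ) Fin.succ).det
      = ∏ i ∈ Finset.range (m+1), b i := by
    rw [Matrix.det_of_lowerTriangular, Finset.prod_range]
    · apply Finset.prod_congr rfl
      intro i _
      simp [hA]
    · intro i j hij
      have hij : (i : ℕ) < j := hij
      simp only [Matrix.submatrix_apply, hA, Fin.succ_last, Fin.succAbove_last, Fin.val_succ,
        Fin.val_castSucc]
      rw [if_neg (by omega), if_neg (by omega), if_neg (by omega)]
  simp only [h0, h1, h2, d1, d2]
  rw [Finset.prod_range_succ' a (m+1)]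
  simp
  ring

theorem det_Rmat_aux (N : ℕ) (hN : 2 ≤ N) (I : ℤ → ℂ) (y : ℂ) :
    (Rmat N I y).det = (∏ n ∈ Finset.range N, I (n + 1)) + (-1) ^ (N + 1) * y := by
  obtain ⟨m, rfl⟩ := Nat.exists_eq_add_of_le' hN
  rw [det_cyc_aux m (fun n => I (n + 1)) (fun _ => 1) y]
  · simp only [Finset.prod_const_one]; ring
  · intro i j; rfl

theorem det_Lmat_aux (N : ℕ) (hN : 2 ≤ N) (V : ℤ → ℂ) (y : ℂ) (hy : y ≠ 0) :
    (Lmat N V y).det = y⁻¹ * (y + (-1) ^ (N + 1) * ∏ n ∈ Finset.range N, V (n + 1)) := by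
  obtain ⟨m, rfl⟩ := Nat.exists_eq_add_of_le' hN
  rw [← Matrix.det_transpose,
    det_cyc_aux m (fun _ => 1) (fun n => V (n + 1)) (V (m + 2 : ℕ) * y⁻¹)]
  · rw [Finset.prod_range_succ (fun n : ℕ => V (n + 1)) (m+1)]
    have : ((m + 2 : ℕ) : ℤ) = ((m + 1 : ℕ) : ℤ) + 1 := by push_cast; ring
    rw [this]
    simp only [Finset.prod_const_one]
    field_simp
    ring
  · intro i j
    simp only [Matrix.transpose_apply, Lmat]
    have e : ((j : ℕ) = (i : ℕ)) ↔ ((i : ℕ) = (j : ℕ)) := eq_comm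
    have e2 : ((j : ℕ) = 0 ∧ (i : ℕ) = m + 2 - 1) ↔ ((i : ℕ) = m + 1 ∧ (j : ℕ) = 0) := by omega
    simp only [e, e2]

theorem det_Rprod_aux (N : ℕ) (hN : 2 ≤ N) (I : ℤ → ℤ → ℂ) (t : ℤ) (y : ℂ) (M : ℕ) :
    (Rprod N I t y M).det = ∏ k ∈ Finset.range M,
            ((∏ n ∈ Finset.range N, I (t + k) (n + 1)) + (-1) ^ (N + 1) * y) := by
  induction M with
  | zero => simp [Rprod]
  | succ k ih => rw [Rprod, Matrix.det_mul, ih, det_Rmat_aux N hN, Finset.prod_range_succ, mul_comm]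

/-- for every `t` and every `y ≠ 0`,
`det X_t(y) = y⁻¹ (y + (-1)^(N+1) ∏_n V^t_n) ∏_{k=0}^{M-1} (∏_n I^{t+k}_n + (-1)^(N+1) y)`. -/
theorem det_Xmat (N M : ℕ) (hN : 2 ≤ N) (hM : 1 ≤ M)
    (I V : ℤ → ℤ → ℂ)
    (hI : ∀ t n : ℤ, I t (n + N) = I t n) (hV : ∀ t n : ℤ, V t (n + N) = V t n) :
    ∀ t : ℤ, ∀ y : ℂ, y ≠ 0 →
      (Xmat N M I V t y).det =
        y⁻¹ * (y + (-1) ^ (N + 1) * ∏ n ∈ Finset.range N, V t (n + 1)) *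
          ∏ k ∈ Finset.range M,
            ((∏ n ∈ Finset.range N, I (t + k) (n + 1)) + (-1) ^ (N + 1) * y) := by
  intro t y hy
  rw [Xmat, Matrix.det_mul, det_Lmat_aux N hN _ y hy, det_Rprod_aux N hN]
end

section
/- Suppose all I^t_n and V^t_n are positive real numbers, the generalized periodic discrete Toda equations hold for all n, t ∈ ℤ (I^{t+M}_n + V^{t+1}_{n−1} = I^t_n + V^t_n and V^{t+1}_n · I^{t+M}_n = I^t_{n+1} · V^t_n), and for every t ∈ ℤ the inequalities ∏_{n=1}^{N} V^t_n < ∏_{n=1}^{N} I^t_n and ∏_{n=1}^{N} V^t_n < ∏_{n=1}^{N} I^{t+M−1}_n hold. Then for every t ∈ ℤ: ∏_{n=1}^{N} V^{t+1}_n = ∏_{n=1}^{N} V^t_n and ∏_{n=1}^{N} I^{t+M}_n = ∏_{n=1}^{N} I^t_n. -/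
lemma shift_prod_aux (N : ℕ) (f : ℤ → ℝ) (hf : ∀ n : ℤ, f (n + N) = f n) (h1 : f 1 ≠ 0) :
    ∏ n ∈ Finset.range N, f ((n : ℤ) + 1 + 1) = ∏ n ∈ Finset.range N, f ((n : ℤ) + 1) := by
  have e1 := Finset.prod_range_succ (fun k : ℕ => f ((k : ℤ) + 1)) N
  have e2 := Finset.prod_range_succ' (fun k : ℕ => f ((k : ℤ) + 1)) N
  have e3 : f ((N : ℤ) + 1) = f 1 := by rw [add_comm]; exact hf 1
  rw [e2] at e1
  simp only [e3, Nat.cast_add, Nat.cast_one, Nat.cast_zero, zero_add] at e1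
  exact mul_right_cancel₀ h1 e1

/-- Lemma 1 of the paper: if all `I^t_n, V^t_n` are positive reals satisfying the
generalized periodic discrete Toda equations and the inequalities
`∏ V^t < ∏ I^t` and `∏ V^t < ∏ I^{t+M-1}` for every `t`, then
`∏ V^{t+1} = ∏ V^t` and `∏ I^{t+M} = ∏ I^t` for every `t`. -/
theorem products_conserved (N M : ℕ) (hN : 2 ≤ N) (hM : 1 ≤ M)
    (I V : ℤ → ℤ → ℝ)
    (hIper : ∀ t n : ℤ, I t (n + N) = I t n) (hVper : ∀ t n : ℤ, V t (n + N) = V t n)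
    (hIpos : ∀ t n : ℤ, 0 < I t n) (hVpos : ∀ t n : ℤ, 0 < V t n)
    (htoda : ∀ n t : ℤ, I (t + M) n + V (t + 1) (n - 1) = I t n + V t n ∧
        V (t + 1) n * I (t + M) n = I t (n + 1) * V t n)
    (hineq1 : ∀ t : ℤ,
      (∏ n ∈ Finset.range N, V t (n + 1)) < ∏ n ∈ Finset.range N, I t (n + 1))
    (hineq2 : ∀ t : ℤ,
      (∏ n ∈ Finset.range N, V t (n + 1)) < ∏ n ∈ Finset.range N, I (t + M - 1) (n + 1)) :
    ∀ t : ℤ,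
      (∏ n ∈ Finset.range N, V (t + 1) (n + 1)) = (∏ n ∈ Finset.range N, V t (n + 1)) ∧
      (∏ n ∈ Finset.range N, I (t + M) (n + 1)) = ∏ n ∈ Finset.range N, I t (n + 1) := by
  intro t
  have hPpos : ∀ f : ℤ → ℝ, (∀ n, 0 < f n) → 0 < ∏ n ∈ Finset.range N, f ((n : ℤ) + 1) :=
    fun f hf => Finset.prod_pos fun n _ => hf _
  have hc := shift_prod_aux N (I t) (hIper t) (hIpos t 1).ne'
  have hprod : (∏ n ∈ Finset.range N, V (t + 1) ((n : ℤ) + 1)) *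
      (∏ n ∈ Finset.range N, I (t + M) ((n : ℤ) + 1)) =
      (∏ n ∈ Finset.range N, I t ((n : ℤ) + 1)) * ∏ n ∈ Finset.range N, V t ((n : ℤ) + 1) := by
    rw [← hc, ← Finset.prod_mul_distrib, ← Finset.prod_mul_distrib]
    exact Finset.prod_congr rfl fun n _ => (htoda _ t).2
  obtain ⟨x, hx⟩ : ∃ x : ℤ → ℝ, ∀ n, x n = I (t + M) n - V t n := ⟨_, fun _ => rfl⟩
  have hrec : ∀ n : ℤ, I t (n + 1) * x n = x (n + 1) * I (t + M) n := by
    intro n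
    have h1 := (htoda (n + 1) t).1
    have h2 := (htoda n t).2
    rw [add_sub_cancel_right] at h1
    rw [hx, hx]
    linear_combination h2 - I (t + M) n * h1
  have hxper : ∀ n : ℤ, x (n + N) = x n := by
    intro n
    rw [hx, hx, hIper, hVper]
  have key : (∏ n ∈ Finset.range N, I (t + M) ((n : ℤ) + 1)) =
      ∏ n ∈ Finset.range N, I t ((n : ℤ) + 1) := by
    by_cases h0 : x 1 = 0
    · exfalso
      have hz : ∀ k : ℕ, x ((k : ℤ) + 1) = 0 := by
        intro k
        induction k with
        | zero => simpa using h0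
        | succ k ih =>
          have h := hrec ((k : ℤ) + 1)
          rw [ih, mul_zero] at h
          push_cast
          exact (mul_eq_zero.mp h.symm).resolve_right (hIpos _ _).ne'
      have hPa : (∏ n ∈ Finset.range N, I (t + M) ((n : ℤ) + 1)) =
          ∏ n ∈ Finset.range N, V t ((n : ℤ) + 1) := by
        refine Finset.prod_congr rfl fun n _ => ?_
        have := hz n
        rw [hx] at this
        linarith
      have i1 := hineq1 t
      have i2 := hineq2 (t + 1)
      rw [show t + 1 + (M : ℤ) - 1 = t + M by ring] at i2
      have hd := hPpos (V t) (hVpos t)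
      rw [hPa] at hprod i2
      have := mul_right_cancel₀ hd.ne' hprod
      linarith
    · have hz : ∀ k : ℕ, x ((k : ℤ) + 1) ≠ 0 := by
        intro k
        induction k with
        | zero => simpa using h0
        | succ k ih =>
          have h := hrec ((k : ℤ) + 1)
          push_cast
          intro h'
          rw [h', zero_mul] at h
          exact (mul_ne_zero (hIpos _ _).ne' ih) h
      have hxs := shift_prod_aux N x hxper h0
      have hP : (∏ n ∈ Finset.range N, I t ((n : ℤ) + 1 + 1)) *
          (∏ n ∈ Finset.range N, x ((n : ℤ) + 1)) =
          (∏ n ∈ Finset.range N, x ((n : ℤ) + 1 + 1)) *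
          ∏ n ∈ Finset.range N, I (t + M) ((n : ℤ) + 1) := by
        rw [← Finset.prod_mul_distrib, ← Finset.prod_mul_distrib]
        exact Finset.prod_congr rfl fun n _ => hrec _
      rw [hc, hxs, mul_comm] at hP
      exact (mul_left_cancel₀ (Finset.prod_ne_zero_iff.mpr fun n _ => hz n) hP).symm
  refine ⟨?_, key⟩
  rw [key, mul_comm] at hprod
  exact mul_left_cancel₀ (hPpos (I t) (hIpos t)).ne' hprod
end

section
/- Assume 1 ≤ M ≤ N−2 and fix t ∈ ℤ. Then the entries (X_t(y))_{2,j} for 1 ≤ j ≤ M+1 do not depend on y ∈ ℂ∖{0}; denote them b_1, …, b_{M+1}. Define the (M+1)×(M+1) complex matrix H by: H_{j,j} = I^t_j for 1 ≤ j ≤ M; H_{j,j+1} = 1 for 1 ≤ j ≤ M; H_{M+1,j} = w_j for 1 ≤ j ≤ M and H_{M+1,M+1} = I^t_{M+1} + w_{M+1}, where w_1 = −b_1, w_2 = x − b_2, and w_j = −b_j for 3 ≤ j ≤ M+1; all other entries of H are 0. Then for every x ∈ ℂ, det H = (−1)^{M+1} · I^t_1 · x. -/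
/-- The entry `b_j := (X_t(y))_{2,j}` (1-based indices), for `1 ≤ j ≤ N`. -/
noncomputable def bEnt (N M : ℕ) (I V : ℤ → ℤ → ℂ) (t : ℤ) (y : ℂ) (j : ℕ) : ℂ :=
  if h : 1 < N ∧ j - 1 < N then Xmat N M I V t y ⟨1, h.1⟩ ⟨j - 1, h.2⟩ else 0

/-- `w_1 = -b_1`, `w_2 = x - b_2`, `w_j = -b_j` for `j ≥ 3`. -/
noncomputable def wEnt (N M : ℕ) (I V : ℤ → ℤ → ℂ) (t : ℤ) (y x : ℂ) (j : ℕ) : ℂ :=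
  if j = 1 then -(bEnt N M I V t y 1)
  else if j = 2 then x - bEnt N M I V t y 2
  else -(bEnt N M I V t y j)

/-- The `(M+1) × (M+1)` matrix `H` (1-based indices): `H_{j,j} = I^t_j` and `H_{j,j+1} = 1`
for `1 ≤ j ≤ M`, last row `H_{M+1,j} = w_j` for `1 ≤ j ≤ M`, `H_{M+1,M+1} = I^t_{M+1} + w_{M+1}`,
and all other entries `0`. -/
noncomputable def Hmat (M : ℕ) (Idiag w : ℕ → ℂ) : Matrix (Fin (M + 1)) (Fin (M + 1)) ℂ :=
  fun i j =>
    if (i : ℕ) < M ∧ (j : ℕ) = (i : ℕ) then Idiag ((i : ℕ) + 1)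
    else if (i : ℕ) < M ∧ (j : ℕ) = (i : ℕ) + 1 then 1
    else if (i : ℕ) = M ∧ (j : ℕ) < M then w ((j : ℕ) + 1)
    else if (i : ℕ) = M ∧ (j : ℕ) = M then Idiag (M + 1) + w (M + 1)
    else 0

lemma Rprod_rec (N : ℕ) (I : ℤ → ℤ → ℂ) (t : ℤ) (y : ℂ) (k i : ℕ) (hi : i + 1 < N) (j : Fin N) :
    Rprod N I t y (k+1) ⟨i, by omega⟩ j =
      I (t + k) (i + 1) * Rprod N I t y k ⟨i, by omega⟩ j + Rprod N I t y k ⟨i+1, hi⟩ j := by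
  rw [Rprod, Matrix.mul_apply]
  have hne : (⟨i, by omega⟩ : Fin N) ≠ ⟨i+1, hi⟩ := by simp
  rw [Finset.sum_eq_add (⟨i, by omega⟩ : Fin N) ⟨i+1, hi⟩ hne]
  · simp [Rmat]
  · intro c _ hc
    have h1 : ¬ (i = (c : ℕ)) := fun h => hc.1 (Fin.ext h.symm)
    have h2 : ¬ ((c : ℕ) = i + 1) := fun h => hc.2 (Fin.ext h)
    have h3 : ¬ (i = N - 1) := by omega
    simp [Rmat, h1, h2, h3]
  · simp
  · simp

lemma X_row (N M : ℕ) (I V : ℤ → ℤ → ℂ) (t : ℤ) (y : ℂ) (hN : 1 < N) (j : Fin N) :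
    Xmat N M I V t y ⟨1, hN⟩ j =
      V t 1 * Rprod N I t y M ⟨0, by omega⟩ j + Rprod N I t y M ⟨1, hN⟩ j := by
  rw [Xmat, Matrix.mul_apply]
  have hne : (⟨0, by omega⟩ : Fin N) ≠ ⟨1, hN⟩ := by simp
  rw [Finset.sum_eq_add (⟨0, by omega⟩ : Fin N) ⟨1, hN⟩ hne]
  · simp [Lmat]
  · intro c _ hc
    have h1 : ¬ (0 = (c : ℕ)) := fun h => hc.1 (Fin.ext h.symm)
    have h2 : ¬ (1 = (c : ℕ)) := fun h => hc.2 (Fin.ext h.symm)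
    have h3 : ¬ (1 = (c : ℕ) + 1) := by omega
    simp only [Lmat, if_neg h2, if_neg h3]
    simp
  · simp
  · simp

lemma Rprod_indep (N : ℕ) (I : ℤ → ℤ → ℂ) (t : ℤ) (y y' : ℂ) (j : Fin N) (k : ℕ) :
    ∀ i : ℕ, ∀ h : i + k < N,
      Rprod N I t y k ⟨i, by omega⟩ j = Rprod N I t y' k ⟨i, by omega⟩ j := by
  induction k with
  | zero => intro i h; rfl
  | succ k ih =>
    intro i h
    rw [Rprod_rec N I t y k i (by omega), Rprod_rec N I t y' k i (by omega),
      ih i (by omega), ih (i+1) (by omega)]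

lemma Rprod_supp (N : ℕ) (I : ℤ → ℤ → ℂ) (t : ℤ) (y : ℂ) (j : Fin N) (k : ℕ) :
    ∀ i : ℕ, ∀ h : i + k < N, i + k ≤ (j : ℕ) →
      Rprod N I t y k ⟨i, by omega⟩ j = if (j : ℕ) = i + k then 1 else 0 := by
  induction k with
  | zero =>
    intro i h _
    simp only [Rprod, Matrix.one_apply, Fin.ext_iff, add_zero]
    simp only [eq_comm]
  | succ k ih =>
    intro i h hj
    rw [Rprod_rec N I t y k i (by omega), ih i (by omega) (by omega),
      ih (i+1) (by omega) (by omega), if_neg (by omega)]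
    simp only [mul_zero, zero_add]
    congr 1
    simp only [eq_iff_iff]
    omega

noncomputable def vv (a : ℕ → ℂ) : ℕ → ℂ
  | 0 => 1
  | n + 1 => -(a (n+1) * vv a n)

lemma Rprod_kill (N : ℕ) (I : ℤ → ℤ → ℂ) (t : ℤ) (y : ℂ) (k : ℕ) :
    ∀ i : ℕ, ∀ h : i + (k + 1) < N,
      ∑ j : Fin N, Rprod N I t y (k+1) ⟨i, by omega⟩ j * vv (fun n => I t n) j = 0 := by
  induction k with
  | zero =>
    intro i h
    simp only [Rprod_rec N I t y 0 i (by omega : i + 1 < N)]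
    simp only [Rprod, add_mul, Finset.sum_add_distrib,
      Matrix.one_apply, mul_assoc, ← Finset.mul_sum, ite_mul, one_mul, zero_mul, Finset.sum_ite_eq,
      Finset.mem_univ, if_true, vv]
    simp
  | succ k ih =>
    intro i h
    simp only [Rprod_rec N I t y (k+1) i (by omega : i + 1 < N), add_mul, Finset.sum_add_distrib,
      mul_assoc, ← Finset.mul_sum]
    rw [ih i (by omega), ih (i+1) (by omega)]
    simp

lemma Hdet (M : ℕ) (a w : ℕ → ℂ) :
    (Hmat M a w).det =
      (-1)^M * (∑ j ∈ Finset.range (M+1), w (j+1) * vv a j + a (M+1) * vv a M) := by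
  set H := Hmat M a w with hH
  let v : Fin (M+1) → ℂ := fun j => vv a j
  have h0 : ∀ i : Fin M, (H.mulVec v) i.castSucc = 0 := by
    intro i
    rw [Matrix.mulVec, dotProduct, Finset.sum_eq_add i.castSucc i.succ]
    · simp [hH, Hmat, v, vv]
    · exact (Fin.castSucc_lt_succ).ne
    · intro c _ hc
      have h1 : ¬ ((c : ℕ) = i) := fun h => hc.1 (Fin.ext h)
      have h2 : ¬ ((c : ℕ) = i + 1) := fun h => hc.2 (Fin.ext h)
      have h3 : ¬ ((i : ℕ) = M) := by omega
      simp [hH, Hmat, h1, h2, h3]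
    · simp
    · simp
  have h1 : (H.mulVec v) (Fin.last M) =
      ∑ j ∈ Finset.range (M+1), w (j+1) * vv a j + a (M+1) * vv a M := by
    rw [Matrix.mulVec, dotProduct, Fin.sum_univ_castSucc, Finset.sum_range_succ,
      ← Fin.sum_univ_eq_sum_range (fun j => w (j+1) * vv a j)]
    simp [hH, Hmat, v]
    ring
  have h2 : H.adjugate 0 (Fin.last M) = (-1)^M := by
    rw [Matrix.adjugate_fin_succ_eq_det_submatrix, Matrix.det_of_lowerTriangular]
    · simp [hH, Hmat]
    · intro i j hij
      have hij' : (i : ℕ) < j := by simpa using hij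
      have e1 : ¬ ((j : ℕ) + 1 = i) := by omega
      have e2 : ¬ ((j : ℕ) = i) := by omega
      have e3 : ¬ ((i : ℕ) = M) := by omega
      simp [hH, Hmat, e1, e2, e3]
  have h3 : H.det * v 0 = (H.adjugate.mulVec (H.mulVec v)) 0 := by
    rw [Matrix.mulVec_mulVec, Matrix.adjugate_mul, Matrix.smul_mulVec, Matrix.one_mulVec]
    simp
  rw [Matrix.mulVec, dotProduct, Fin.sum_univ_castSucc] at h3
  simp only [h0, h1, h2, mul_zero, Finset.sum_const_zero, zero_add] at h3
  simpa [v, vv] using h3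

/-- Lemma 4 of the paper: for `1 ≤ M ≤ N-2`, the entries `(X_t(y))_{2,j}`,
`1 ≤ j ≤ M+1`, do not depend on `y ≠ 0`, and the matrix `H` built from them satisfies
`det H = (-1)^(M+1) I^t_1 x`. -/
theorem det_Hmat (N M : ℕ) (hN : 2 ≤ N) (hM : 1 ≤ M) (hMN : M ≤ N - 2)
    (I V : ℤ → ℤ → ℂ)
    (hI : ∀ t n : ℤ, I t (n + N) = I t n) (hV : ∀ t n : ℤ, V t (n + N) = V t n)
    (t : ℤ) (x : ℂ) :
    (∀ y y' : ℂ, y ≠ 0 → y' ≠ 0 → ∀ j : ℕ, ∀ _hj1 : 1 ≤ j, ∀ _hj2 : j ≤ M + 1,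
      Xmat N M I V t y ⟨1, by omega⟩ ⟨j - 1, by omega⟩ =
        Xmat N M I V t y' ⟨1, by omega⟩ ⟨j - 1, by omega⟩) ∧
    (∀ y : ℂ, y ≠ 0 →
      (Hmat M (fun n => I t n) (wEnt N M I V t y x)).det = (-1) ^ (M + 1) * I t 1 * x) := by
  refine ⟨?_, ?_⟩
  · intro y y' _ _ j _ _
    rw [X_row N M I V t y (by omega), X_row N M I V t y' (by omega),
      Rprod_indep N I t y y' _ M 0 (by omega), Rprod_indep N I t y y' _ M 1 (by omega)]
  · intro y _
    rw [Hdet]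
    set a : ℕ → ℂ := fun n => I t n with ha
    have hb : ∀ j : Fin N, bEnt N M I V t y (j+1) = Xmat N M I V t y ⟨1, by omega⟩ j := by
      intro j
      have h : 1 < N ∧ (j : ℕ) + 1 - 1 < N := by omega
      rw [bEnt, dif_pos h]
      rfl
    have hk : ∑ j ∈ Finset.range N, bEnt N M I V t y (j+1) * vv a j = 0 := by
      rw [← Fin.sum_univ_eq_sum_range (fun j => bEnt N M I V t y (j+1) * vv a j)]
      obtain ⟨k, rfl⟩ : ∃ k, M = k + 1 := ⟨M - 1, by omega⟩
      simp only [hb, X_row N _ I V t y (by omega : 1 < N), add_mul, Finset.sum_add_distrib,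
        mul_assoc, ← Finset.mul_sum]
      rw [Rprod_kill N I t y k 0 (by omega), Rprod_kill N I t y k 1 (by omega)]
      simp
    have hs : ∀ j : ℕ, j < N → M + 1 ≤ j →
        bEnt N M I V t y (j+1) = if j = M + 1 then 1 else 0 := by
      intro j hj hMj
      have := hb ⟨j, hj⟩
      simp only at this
      rw [this, X_row N M I V t y (by omega), Rprod_supp N I t y _ M 0 (by omega) (by simp; omega),
        Rprod_supp N I t y _ M 1 (by omega) (by simp; omega)]
      simp only
      rw [if_neg (by omega)]
      simp [add_comm]
    have hk2 : ∑ j ∈ Finset.range (M+2), bEnt N M I V t y (j+1) * vv a j = 0 := by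
      rw [← hk]
      apply Finset.sum_subset
      · intro j; simp only [Finset.mem_range]; omega
      · intro j h1 h2
        simp only [Finset.mem_range] at h1 h2
        rw [hs j h1 (by omega), if_neg (by omega), zero_mul]
    rw [Finset.sum_range_succ, hs (M+1) (by omega) le_rfl, if_pos rfl] at hk2
    have hw : ∑ j ∈ Finset.range (M+1), wEnt N M I V t y x (j+1) * vv a j =
        - ∑ j ∈ Finset.range (M+1), bEnt N M I V t y (j+1) * vv a j + x * vv a 1 := by
      have : ∀ j ∈ Finset.range (M+1), wEnt N M I V t y x (j+1) * vv a j =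
          -(bEnt N M I V t y (j+1) * vv a j) + if j = 1 then x * vv a 1 else 0 := by
        intro j _
        rcases j with _ | _ | j
        · simp [wEnt]
        · simp [wEnt]; ring
        · simp [wEnt]
      rw [Finset.sum_congr rfl this, Finset.sum_add_distrib, Finset.sum_neg_distrib,
        Finset.sum_ite_eq', if_pos (by simp; omega)]
    have e1 : vv a (M+1) = -(a (M+1) * vv a M) := rfl
    have e2 : vv a 1 = - I t 1 := by simp [vv, ha]
    rw [hw, e2]
    rw [e1] at hk2
    rw [pow_succ]
    linear_combination -(-1)^M * hk2
end
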